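/- Let (R,m) be a Noetherian local ring or a standard graded K-algebra with graded maximal ideal m, and let I ⊆ m be an ideal (graded if R is graded). Then for every j ≥ 1 there exists an integer c_j such that ρ_j(I^k) = c_j for all sufficiently large k, where ρ_j(I^k) is the Artin-Rees number of the j-th syzygy module of I^k inside the (j−1)-st free module of a minimal free R-resolution of I^k. -/

import Mathlib

open Submodule IsLocalRing

/-- A minimal free resolution `… → F_1 → F_0 → M → 0` of a module `M` over a local ring
with maximal ideal `m`, with `F_i = R^{b i}`: the augmentation `aug : F_0 → M` is
surjective, the complex is exact, and all differentials (including the one computing the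
first syzygy `ker aug`) have image inside `m F_i`. -/
structure MinFreeRes (R : Type*) [CommRing R] (m : Ideal R) (M : Type*) [AddCommGroup M]
    [Module R M] where
  b : ℕ → ℕ
  aug : (Fin (b 0) → R) →ₗ[R] M
  d : ∀ i : ℕ, (Fin (b (i + 1)) → R) →ₗ[R] (Fin (b i) → R)
  aug_surj : Function.Surjective aug
  exact_aug : LinearMap.ker aug = LinearMap.range (d 0)
  exact : ∀ i : ℕ, LinearMap.ker (d i) = LinearMap.range (d (i + 1))
  minimal : ∀ i : ℕ, LinearMap.range (d i) ≤ m • (⊤ : Submodule R (Fin (b i) → R))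

/-- The Artin–Rees number `ρ(N, P)` with respect to an ideal `m`: the smallest `r` such
that `N ∩ m^i P = m^{i-r} (N ∩ m^r P)` for all `i ≥ r`. -/
noncomputable def artinReesNumber {R : Type*} [CommRing R] {M : Type*} [AddCommGroup M]
    [Module R M] (m : Ideal R) (N P : Submodule R M) : ℕ :=
  sInf {r : ℕ | ∀ i : ℕ, r ≤ i → N ⊓ m ^ i • P = m ^ (i - r) • (N ⊓ m ^ r • P)}

/-- `ρ_j(M)` for `j ≥ 1`: the Artin–Rees number of the `j`-th syzygy module
`N_j = Im(φ_j) = Range (d (j-1)) ⊆ F_{j-1}` of a minimal free resolution. -/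
noncomputable def MinFreeRes.rho {R : Type*} [CommRing R] {m : Ideal R} {M : Type*}
    [AddCommGroup M] [Module R M] (F : MinFreeRes R m M) (j : ℕ) : ℕ :=
  artinReesNumber m (LinearMap.range (F.d (j - 1))) ⊤

universe u

section StableRetract

variable {R M M' P P' : Type u} [CommRing R] [AddCommGroup M] [Module R M]
  [AddCommGroup M'] [Module R M'] [AddCommGroup P] [Module R P] [AddCommGroup P'] [Module R P']

/-- `M` is a direct summand of `M'` up to an endomorphism of `M` factoring through a projective
module. -/
def IsStableRetract (R M M' : Type u) [CommRing R] [AddCommGroup M] [Module R M]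
    [AddCommGroup M'] [Module R M'] : Prop :=
  ∃ (f : M →ₗ[R] M') (g : M' →ₗ[R] M) (Q : ModuleCat.{u} R) (p : M →ₗ[R] Q) (q : Q →ₗ[R] M),
    Module.Projective R Q ∧ ∀ x, x = g (f x) + q (p x)

/-- The condition that passing from `N ∩ m^i P` to `N ∩ m^(i+1) P` only requires multiplication
by `m`. -/
def ArtinReesStep (m : Ideal R) (N L : Submodule R M) (i : ℕ) : Prop :=
  N ⊓ m ^ (i + 1) • L ≤ m • (N ⊓ m ^ i • L)

theorem LinearEquiv.isStableRetract (e : M ≃ₗ[R] M') : IsStableRetract R M M' :=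
  ⟨e, e.symm, ModuleCat.of R R, 0, 0, inferInstanceAs (Module.Projective R R), by simp⟩

theorem IsStableRetract.exists_lift [Module.Projective R P] [Module.Projective R P']
    (h : IsStableRetract R M M') {π : P →ₗ[R] M} (hπ : Function.Surjective π)
    {π' : P' →ₗ[R] M'} (hπ' : Function.Surjective π') :
    ∃ (F : P →ₗ[R] P') (G : P' →ₗ[R] P) (H : P →ₗ[R] LinearMap.ker π),
      (∀ x, π x = 0 → π' (F x) = 0) ∧ (∀ x, π' x = 0 → π (G x) = 0) ∧
      ∀ x, π x = 0 → x = G (F x) + H x := by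
  obtain ⟨f, g, Q, p, q, hQ, hfg⟩ := h
  obtain ⟨F, hF⟩ := Module.projective_lifting_property π' (f ∘ₗ π) hπ'
  obtain ⟨G, hG⟩ := Module.projective_lifting_property π (g ∘ₗ π') hπ
  obtain ⟨q', hq'⟩ := Module.projective_lifting_property π q hπ
  have hF' (x) : π' (F x) = f (π x) := LinearMap.congr_fun hF x
  have hG' (x) : π (G x) = g (π' x) := LinearMap.congr_fun hG x
  have hq'' (x) : π (q' x) = q x := LinearMap.congr_fun hq' x
  refine ⟨F, G, LinearMap.codRestrict _ (LinearMap.id - G ∘ₗ F - q' ∘ₗ p ∘ₗ π) fun x ↦ ?_,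
    fun x hx ↦ by simp [hF', hx], fun x hx ↦ by simp [hG', hx], fun x hx ↦ by simp [hx]⟩
  have := hfg (π x)
  simp only [LinearMap.mem_ker, LinearMap.sub_apply, LinearMap.id_apply, LinearMap.comp_apply,
    map_sub, hF', hG', hq'']
  nth_rewrite 1 [this]
  abel

theorem IsStableRetract.ker [Module.Projective R P] [Module.Projective R P']
    (h : IsStableRetract R M M') {π : P →ₗ[R] M} (hπ : Function.Surjective π)
    {π' : P' →ₗ[R] M'} (hπ' : Function.Surjective π') :
    IsStableRetract R (LinearMap.ker π) (LinearMap.ker π') := by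
  obtain ⟨F, G, H, hF, hG, hH⟩ := h.exists_lift hπ hπ'
  refine ⟨F.restrict hF, G.restrict hG, ModuleCat.of R P, (LinearMap.ker π).subtype, H, ‹_›, ?_⟩
  intro x
  ext
  exact hH x x.2

theorem IsStableRetract.artinReesStep [Module.Projective R P] [Module.Projective R P']
    (h : IsStableRetract R M M') {π : P →ₗ[R] M} (hπ : Function.Surjective π)
    {π' : P' →ₗ[R] M'} (hπ' : Function.Surjective π') {m : Ideal R} {i : ℕ}
    (hi : ArtinReesStep m (LinearMap.ker π') ⊤ i) : ArtinReesStep m (LinearMap.ker π) ⊤ i := by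
  obtain ⟨F, G, H, hF, hG, hH⟩ := h.exists_lift hπ hπ'
  have smul_map {A B : Type u} [AddCommGroup A] [Module R A] [AddCommGroup B] [Module R B]
      (f : A →ₗ[R] B) (J : Ideal R) {x : A} (hx : x ∈ J • (⊤ : Submodule R A)) :
      f x ∈ J • (⊤ : Submodule R B) :=
    Submodule.smul_mono (le_refl J) le_top
      (Submodule.map_smul'' J ⊤ f ▸ Submodule.mem_map_of_mem hx)
  rintro x ⟨hx, hx'⟩
  rw [hH x hx]
  refine add_mem ?_ ?_
  · have h1 : F x ∈ m • (LinearMap.ker π' ⊓ m ^ i • ⊤) := hi ⟨hF x hx, smul_map F _ hx'⟩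
    have h2 := Submodule.mem_map_of_mem (f := G) h1
    rw [Submodule.map_smul''] at h2
    refine Submodule.smul_mono (le_refl m) ?_ h2
    rintro _ ⟨y, ⟨hy, hy'⟩, rfl⟩
    exact ⟨hG y hy, smul_map G _ hy'⟩
  · have h1 := Submodule.mem_map_of_mem (f := (LinearMap.ker π).subtype) (smul_map H _ hx')
    rw [pow_succ', Submodule.mul_smul, Submodule.map_smul'', Submodule.map_smul''] at h1
    refine Submodule.smul_mono (le_refl m) ?_ h1
    rw [Submodule.map_top, Submodule.range_subtype]
    exact le_inf Submodule.smul_le_right (Submodule.smul_mono (le_refl _) le_top)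

theorem artinReesStep_map_iff {f : M →ₗ[R] M'} (hf : Function.Injective f) {m : Ideal R}
    {N L : Submodule R M} {i : ℕ} :
    ArtinReesStep m (N.map f) (L.map f) i ↔ ArtinReesStep m N L i := by
  simp only [ArtinReesStep, ← Submodule.map_smul'', ← Submodule.map_inf f hf,
    Submodule.map_le_map_iff_of_injective hf]

theorem artinReesNumber_eq (m : Ideal R) (N L : Submodule R M) :
    artinReesNumber m N L = sInf {r | ∀ i, r ≤ i → ArtinReesStep m N L i} := by
  unfold artinReesNumber
  congr 1
  ext r
  refine ⟨fun h i hi ↦ ?_, fun h i hi ↦ ?_⟩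
  · unfold ArtinReesStep
    rw [h (i + 1) (by omega), h i hi, ← Submodule.mul_smul, ← pow_succ', Nat.sub_add_comm hi]
  · refine le_antisymm ?_ (le_inf ?_ ?_)
    · induction i, hi using Nat.le_induction with
      | base => simp
      | succ i hi ih =>
        refine (h i hi).trans ?_
        rw [Nat.sub_add_comm hi, pow_succ', Submodule.mul_smul]
        exact smul_mono_right m ih
    · exact Submodule.smul_le_right.trans inf_le_left
    · refine (smul_mono_right _ inf_le_right).trans ?_
      rw [← Submodule.mul_smul, ← pow_add, Nat.sub_add_cancel hi]

end StableRetract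

section Graded

open MvPolynomial

variable {R : Type u} [CommRing R] {σ ι : Type}

/-- Projection of `ι → R[σ]` to its component of degree `k`. -/
noncomputable def gradedProj (R : Type u) [CommRing R] (σ ι : Type) (k : ℕ) :
    (ι → MvPolynomial σ R) →ₗ[R] (ι → MvPolynomial σ R) :=
  LinearMap.pi fun a ↦ homogeneousComponent k ∘ₗ LinearMap.proj a

/-- The component of degree `k` of a submodule of `ι → R[σ]`. -/
noncomputable def strand (N : Submodule (MvPolynomial σ R) (ι → MvPolynomial σ R)) (k : ℕ) :
    Submodule R (ι → MvPolynomial σ R) :=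
  N.restrictScalars R ⊓ LinearMap.range (gradedProj R σ ι k)

/-- A submodule of `ι → R[σ]` is graded if it contains the components of its elements. -/
def IsGradedSubmodule (N : Submodule (MvPolynomial σ R) (ι → MvPolynomial σ R)) : Prop :=
  ∀ k, ∀ v ∈ N, gradedProj R σ ι k v ∈ N

@[simp]
theorem gradedProj_apply (k : ℕ) (v : ι → MvPolynomial σ R) (a : ι) :
    gradedProj R σ ι k v a = homogeneousComponent k (v a) := rfl

theorem mem_range_gradedProj {k : ℕ} {v : ι → MvPolynomial σ R} :
    v ∈ LinearMap.range (gradedProj R σ ι k) ↔ ∀ a, (v a).IsHomogeneous k := by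
  refine ⟨?_, fun h ↦ ⟨v, funext fun a ↦ homogeneousComponent_eq_self (h a)⟩⟩
  rintro ⟨w, rfl⟩ a
  exact homogeneousComponent_isHomogeneous k (w a)

theorem gradedProj_of_mem {k : ℕ} {v : ι → MvPolynomial σ R}
    (hv : v ∈ LinearMap.range (gradedProj R σ ι k)) : gradedProj R σ ι k v = v :=
  funext fun a ↦ homogeneousComponent_eq_self (mem_range_gradedProj.1 hv a)

theorem smul_mem_range_gradedProj {k l : ℕ} {p : MvPolynomial σ R} (hp : p.IsHomogeneous k)
    {v : ι → MvPolynomial σ R} (hv : v ∈ LinearMap.range (gradedProj R σ ι l)) :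
    p • v ∈ LinearMap.range (gradedProj R σ ι (k + l)) :=
  mem_range_gradedProj.2 fun a ↦ hp.mul (mem_range_gradedProj.1 hv a)

theorem gradedProj_add_smul (k l : ℕ) (p : MvPolynomial σ R)
    {v : ι → MvPolynomial σ R} (hv : v ∈ LinearMap.range (gradedProj R σ ι l)) :
    gradedProj R σ ι (k + l) (p • v) = homogeneousComponent k p • v := by
  classical
  let _ := MvPolynomial.gradedAlgebra (σ := σ) (R := R)
  funext a
  have := DirectSum.coe_decompose_mul_add_of_right_mem (homogeneousSubmodule σ R) (a := p) (i := k)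
    (mem_range_gradedProj.1 hv a)
  exact (decomposition.decompose'_apply _ _).symm.trans
    (this.trans (congrArg (· * v a) (decomposition.decompose'_apply _ _)))

theorem smul_mem_strand {N : Submodule (MvPolynomial σ R) (ι → MvPolynomial σ R)} {k l : ℕ}
    {p : MvPolynomial σ R} (hp : p.IsHomogeneous k) {v : ι → MvPolynomial σ R}
    (hv : v ∈ strand N l) : p • v ∈ strand N (k + l) :=
  ⟨N.smul_mem p hv.1, smul_mem_range_gradedProj hp hv.2⟩

theorem IsGradedSubmodule.gradedProj_mem_strand
    {N : Submodule (MvPolynomial σ R) (ι → MvPolynomial σ R)} (hN : IsGradedSubmodule N) (k : ℕ)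
    {v : ι → MvPolynomial σ R} (hv : v ∈ N) : gradedProj R σ ι k v ∈ strand N k :=
  ⟨hN k v hv, v, rfl⟩

/-- The submodule of vectors with all coefficients in `J`. -/
noncomputable abbrev coeffSubmodule (J : Ideal R) (σ ι : Type) :
    Submodule (MvPolynomial σ R) (ι → MvPolynomial σ R) :=
  J.map (algebraMap R (MvPolynomial σ R)) • ⊤

theorem restrictScalars_coeffSubmodule (J : Ideal R) :
    (coeffSubmodule J σ ι).restrictScalars R = J • ⊤ :=
  Ideal.smul_restrictScalars J ⊤

theorem IsGradedSubmodule.inf_coeffSubmodule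
    {N : Submodule (MvPolynomial σ R) (ι → MvPolynomial σ R)} (hN : IsGradedSubmodule N)
    (J : Ideal R) : IsGradedSubmodule (N ⊓ coeffSubmodule J σ ι) := by
  rintro k v ⟨hv, hv'⟩
  refine ⟨hN k v hv, ?_⟩
  rw [SetLike.mem_coe, ← Submodule.restrictScalars_mem R, restrictScalars_coeffSubmodule] at hv' ⊢
  have := Submodule.mem_map_of_mem (f := gradedProj R σ ι k) hv'
  rw [Submodule.map_smul''] at this
  exact Submodule.smul_mono (le_refl J) le_top this

theorem strand_inf_coeffSubmodule (N : Submodule (MvPolynomial σ R) (ι → MvPolynomial σ R))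
    (J : Ideal R) (k : ℕ) :
    strand (N ⊓ coeffSubmodule J σ ι) k =
      strand N k ⊓ J • LinearMap.range (gradedProj R σ ι k) := by
  refine le_antisymm ?_ ?_
  · rintro v ⟨⟨hv, hv'⟩, hk⟩
    refine ⟨⟨hv, hk⟩, ?_⟩
    rw [SetLike.mem_coe, ← Submodule.restrictScalars_mem R, restrictScalars_coeffSubmodule] at hv'
    have := Submodule.mem_map_of_mem (f := gradedProj R σ ι k) hv'
    rwa [Submodule.map_smul'', Submodule.map_top, gradedProj_of_mem hk] at this
  · rintro v ⟨⟨hv, hk⟩, hv'⟩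
    refine ⟨⟨hv, ?_⟩, hk⟩
    rw [SetLike.mem_coe, ← Submodule.restrictScalars_mem R, restrictScalars_coeffSubmodule]
    exact Submodule.smul_mono (le_refl J) le_top hv'

theorem smul_mem_iSup_map_strand {N : Submodule (MvPolynomial σ R) (ι → MvPolynomial σ R)}
    {e k : ℕ} {p : MvPolynomial σ R} (hp : p.IsHomogeneous (e + 1)) {v : ι → MvPolynomial σ R}
    (hv : v ∈ strand N k) :
    p • v ∈ ⨆ l : σ, (strand N (e + k)).map (Algebra.lsmul R R _ (X l : MvPolynomial σ R)) := by
  rw [← p.support_sum_monomial_coeff, Finset.sum_smul]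
  refine Submodule.sum_mem _ fun α hα ↦ ?_
  have hdeg : α.degree = e + 1 := by
    by_contra h
    exact (mem_support_iff.1 hα) (hp.coeff_eq_zero h)
  obtain ⟨l, hl⟩ : ∃ l, α l ≠ 0 := by
    by_contra! h
    simp [show α = 0 from Finsupp.ext h] at hdeg
  have hle : Finsupp.single l 1 ≤ α := Finsupp.single_le_iff.2 (Nat.one_le_iff_ne_zero.2 hl)
  have hα' : α - Finsupp.single l 1 + Finsupp.single l 1 = α := tsub_add_cancel_of_le hle
  refine Submodule.mem_iSup_of_mem l
    ⟨monomial (α - Finsupp.single l 1) (coeff α p) • v, smul_mem_strand ?_ hv, ?_⟩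
  · refine isHomogeneous_monomial _ ?_
    have := congrArg Finsupp.degree hα'
    rw [map_add, hdeg, Finsupp.degree_single] at this
    omega
  · rw [Algebra.lsmul_coe]
    beta_reduce
    rw [smul_smul, X, monomial_mul, one_mul, add_comm, hα']

theorem exists_strand_succ_le [IsNoetherianRing R] [Finite σ] [Finite ι]
    (N : Submodule (MvPolynomial σ R) (ι → MvPolynomial σ R)) :
    ∃ d, ∀ k, d ≤ k → strand N (k + 1) ≤
      ⨆ l : σ, (strand N k).map (Algebra.lsmul R R _ (X l : MvPolynomial σ R)) := by
  let U : ℕ →o Submodule (MvPolynomial σ R) (ι → MvPolynomial σ R) :=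
    { toFun := fun k ↦ Submodule.span _ (⋃ i ≤ k, (strand N i : Set (ι → MvPolynomial σ R)))
      monotone' := fun a b hab ↦ Submodule.span_mono <|
        Set.biUnion_subset_biUnion_left fun i hi ↦ le_trans hi hab }
  obtain ⟨d, hd⟩ := monotone_stabilizes_iff_noetherian.mpr
    (inferInstance : IsNoetherian (MvPolynomial σ R) (ι → MvPolynomial σ R)) U
  refine ⟨d, fun k hk v hv ↦ ?_⟩
  have hvU : v ∈ U k := by
    rw [← hd k hk, hd (k + 1) (by omega)]
    exact Submodule.subset_span (Set.mem_iUnion₂_of_mem (i := k + 1) le_rfl hv)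
  have key : ∀ w ∈ U k, ∀ t : MvPolynomial σ R, gradedProj R σ ι (k + 1) (t • w) ∈
      ⨆ l : σ, (strand N k).map (Algebra.lsmul R R _ (X l : MvPolynomial σ R)) := by
    intro w hw
    induction hw using Submodule.span_induction with
    | mem w hw =>
      intro t
      obtain ⟨i, hi, hwi⟩ := Set.mem_iUnion₂.1 hw
      obtain ⟨e, rfl⟩ := Nat.exists_eq_add_of_le' hi
      rw [add_right_comm, gradedProj_add_smul _ _ _ hwi.2]
      exact smul_mem_iSup_map_strand (homogeneousComponent_isHomogeneous _ _) hwi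
    | zero => simp
    | add x y _ _ hx hy => intro t; rw [smul_add, map_add]; exact add_mem (hx t) (hy t)
    | smul a x _ hx => intro t; rw [smul_smul]; exact hx _
  simpa [gradedProj_of_mem hv.2] using key v hvU 1

/-- A graded submodule agrees, in all large degrees, with the image of a free module generated in
a single degree; the kernel is again graded. -/
theorem IsGradedSubmodule.exists_presentation [IsNoetherianRing R] [Finite σ] [Finite ι]
    {N : Submodule (MvPolynomial σ R) (ι → MvPolynomial σ R)} (hN : IsGradedSubmodule N) :
    ∃ (n d : ℕ) (φ : (Fin n → MvPolynomial σ R) →ₗ[MvPolynomial σ R] (ι → MvPolynomial σ R)),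
      IsGradedSubmodule (LinearMap.ker φ) ∧
      ∀ k, (LinearMap.range (gradedProj R σ (Fin n) k)).map (φ.restrictScalars R) =
        strand N (k + d) := by
  obtain ⟨d, hd⟩ := exists_strand_succ_le N
  obtain ⟨S, hS, hspan⟩ := (Submodule.fg_span_iff_fg_span_finset_subset _).1
    (IsNoetherian.noetherian (Submodule.span (MvPolynomial σ R) (strand N d : Set (ι → MvPolynomial σ R))))
  obtain ⟨n, w, -, hw⟩ := S.finite_toSet.fin_param
  have hwd (a : Fin n) : w a ∈ strand N d := hS (hw ▸ Set.mem_range_self a)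
  let φ := Fintype.linearCombination (MvPolynomial σ R) w
  have hrange : LinearMap.range φ = Submodule.span _ (strand N d : Set (ι → MvPolynomial σ R)) := by
    rw [hspan, ← hw]
    exact Fintype.range_linearCombination (MvPolynomial σ R) w
  have hφ (k : ℕ) (t) : gradedProj R σ ι (k + d) (φ t) = φ (gradedProj R σ (Fin n) k t) := by
    simp only [φ, Fintype.linearCombination_apply, map_sum, gradedProj_add_smul _ _ _ (hwd _).2,
      gradedProj_apply]
  have hle (k : ℕ) : strand N (k + d) ≤ (LinearMap.range φ).restrictScalars R := by
    induction k with
    | zero =>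
      rw [zero_add, hrange]
      exact fun v hv ↦ Submodule.subset_span (R := MvPolynomial σ R) hv
    | succ k ih =>
      rw [add_right_comm]
      refine (hd (k + d) (by omega)).trans (iSup_le fun l ↦ ?_)
      rintro _ ⟨v, hv, rfl⟩
      exact Submodule.smul_mem (LinearMap.range φ) _ (ih hv)
  refine ⟨n, d, φ, fun k t ht ↦ ?_, fun k ↦ le_antisymm ?_ fun v hv ↦ ?_⟩
  · rw [LinearMap.mem_ker] at ht ⊢
    rw [← hφ, ht, map_zero]
  · rintro _ ⟨_, ⟨t, rfl⟩, rfl⟩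
    rw [LinearMap.restrictScalars_apply, ← hφ]
    refine hN.gradedProj_mem_strand _ ?_
    have h : φ t ∈ LinearMap.range φ := ⟨t, rfl⟩
    rw [hrange] at h
    exact Submodule.span_le.2 (fun x hx ↦ hx.1) h
  · obtain ⟨t, rfl⟩ := hle k hv
    exact ⟨_, ⟨t, rfl⟩, by rw [LinearMap.restrictScalars_apply, ← hφ, gradedProj_of_mem hv.2]⟩

theorem IsGradedSubmodule.exists_forall_artinReesStep [IsNoetherianRing R] [Finite σ] [Finite ι]
    {N : Submodule (MvPolynomial σ R) (ι → MvPolynomial σ R)} (hN : IsGradedSubmodule N)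
    (m : Ideal R) : ∃ i₀, ∀ i, i₀ ≤ i → ∀ k,
      ArtinReesStep m (strand N k) (LinearMap.range (gradedProj R σ ι k)) i := by
  obtain ⟨i₀, h⟩ := Ideal.exists_pow_inf_eq_pow_smul (m.map (algebraMap R (MvPolynomial σ R))) N
  refine ⟨i₀, fun i hi k ↦ ?_⟩
  have hstep : N ⊓ coeffSubmodule (m ^ (i + 1)) σ ι =
      m.map (algebraMap R (MvPolynomial σ R)) • (N ⊓ coeffSubmodule (m ^ i) σ ι) := by
    have h1 := h (i + 1) (by omega)
    rw [Nat.sub_add_comm hi, pow_succ' _ (i - i₀), Submodule.mul_smul, ← h i hi] at h1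
    rwa [inf_comm N, inf_comm N, coeffSubmodule, coeffSubmodule, Ideal.map_pow, Ideal.map_pow]
  unfold ArtinReesStep
  rw [← strand_inf_coeffSubmodule, ← strand_inf_coeffSubmodule, hstep]
  rintro v ⟨hv, hk⟩
  rw [Ideal.smul_restrictScalars] at hv
  have := Submodule.mem_map_of_mem (f := gradedProj R σ ι k) hv
  rw [gradedProj_of_mem hk, Submodule.map_smul''] at this
  refine Submodule.smul_mono (le_refl m) ?_ this
  rintro _ ⟨w, hw, rfl⟩
  exact (hN.inf_coeffSubmodule _).gradedProj_mem_strand k hw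

theorem exists_artinReesStep_succ [IsNoetherianRing R] [Finite σ] [Finite ι]
    (N : Submodule (MvPolynomial σ R) (ι → MvPolynomial σ R))
    (m : Ideal R) (i : ℕ) : ∃ d, ∀ k, d ≤ k →
      ArtinReesStep m (strand N k) (LinearMap.range (gradedProj R σ ι k)) i →
      ArtinReesStep m (strand N (k + 1)) (LinearMap.range (gradedProj R σ ι (k + 1))) i := by
  obtain ⟨d, hd⟩ := exists_strand_succ_le (N ⊓ coeffSubmodule (m ^ (i + 1)) σ ι)
  refine ⟨d, fun k hk h ↦ ?_⟩
  unfold ArtinReesStep at h ⊢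
  simp only [← strand_inf_coeffSubmodule] at h ⊢
  refine (hd k hk).trans (iSup_le fun l ↦ (Submodule.map_mono h).trans ?_)
  rw [Submodule.map_smul'']
  refine smul_mono_right m ?_
  rintro _ ⟨v, hv, rfl⟩
  rw [add_comm k]
  exact smul_mem_strand (isHomogeneous_X R l) hv

/-- For large degrees, the set of failing Artin–Rees steps of a graded submodule is constant. -/
theorem IsGradedSubmodule.exists_artinReesStep_iff [IsNoetherianRing R] [Finite σ] [Finite ι]
    {N : Submodule (MvPolynomial σ R) (ι → MvPolynomial σ R)} (hN : IsGradedSubmodule N)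
    (m : Ideal R) : ∃ k₀, ∀ k, k₀ ≤ k → ∀ i,
      (ArtinReesStep m (strand N k) (LinearMap.range (gradedProj R σ ι k)) i ↔
        ArtinReesStep m (strand N k₀) (LinearMap.range (gradedProj R σ ι k₀)) i) := by
  obtain ⟨i₀, hi₀⟩ := hN.exists_forall_artinReesStep m
  let S (k i : ℕ) := ArtinReesStep m (strand N k) (LinearMap.range (gradedProj R σ ι k)) i
  have hS (i : ℕ) : ∃ d, ∀ k, d ≤ k → (S k i ↔ S d i) := by
    obtain ⟨d, hd⟩ := exists_artinReesStep_succ N m i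
    by_cases h : ∃ k, d ≤ k ∧ S k i
    · obtain ⟨k, hk, h⟩ := h
      refine ⟨k, fun l hl ↦ iff_of_true ?_ h⟩
      induction l, hl using Nat.le_induction with
      | base => exact h
      | succ l hl ih => exact hd l (hk.trans hl) ih
    · push Not at h
      exact ⟨d, fun k hk ↦ iff_of_false (h k hk) (h d le_rfl)⟩
  choose d hd using hS
  refine ⟨(Finset.range i₀).sup d, fun k hk i ↦ ?_⟩
  by_cases hi : i₀ ≤ i
  · exact iff_of_true (hi₀ i hi k) (hi₀ i hi _)
  · have hle : d i ≤ (Finset.range i₀).sup d :=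
      Finset.le_sup (Finset.mem_range.2 (not_le.1 hi))
    exact (hd i k (hle.trans hk)).trans (hd i _ hle).symm

instance projective_range_gradedProj [Finite ι] (k : ℕ) :
    Module.Projective R (LinearMap.range (gradedProj R σ ι k)) :=
  Module.Projective.of_split (Submodule.subtype _) (LinearMap.rangeRestrict _)
    (LinearMap.ext fun v ↦ Subtype.ext (gradedProj_of_mem v.2))

theorem coeff_aeval_C_mul_X (f : σ → R) (p : MvPolynomial σ R) (k : ℕ) :
    (aeval (fun l ↦ Polynomial.C (f l) * Polynomial.X) p).coeff k =
      aeval f (homogeneousComponent k p) := by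
  classical
  have : Polynomial.lcoeff R k ∘ₗ
      (aeval fun l ↦ Polynomial.C (f l) * Polynomial.X : MvPolynomial σ R →ₐ[R] _).toLinearMap =
      (aeval f).toLinearMap ∘ₗ homogeneousComponent k := by
    refine MvPolynomial.linearMap_ext fun α ↦ LinearMap.ext fun c ↦ ?_
    have h1 : (α.prod fun l e ↦ (Polynomial.C (f l) * Polynomial.X) ^ e) =
        Polynomial.C (α.prod fun l e ↦ f l ^ e) * Polynomial.X ^ α.degree := by
      simp only [mul_pow, Finsupp.prod, Finset.prod_mul_distrib, map_prod, map_pow,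
        Finset.prod_pow_eq_pow_sum, Finsupp.degree_apply]
    have h2 := homogeneousComponent_of_mem (m := k)
      ((mem_homogeneousSubmodule α.degree _).2 (isHomogeneous_monomial c rfl))
    simp only [LinearMap.comp_apply, AlgHom.toLinearMap_apply, aeval_monomial, h1, h2,
      Polynomial.lcoeff_apply]
    rw [← mul_assoc, Polynomial.algebraMap_eq, ← Polynomial.C_mul, Polynomial.coeff_C_mul_X_pow]
    split_ifs <;> simp [aeval_monomial]
  exact LinearMap.congr_fun this p

/-- The relations of the Rees algebra of `(f l)_l`. -/
noncomputable def reesRelations (f : σ → R) :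
    Submodule (MvPolynomial σ R) (Fin 1 → MvPolynomial σ R) :=
  Submodule.comap (LinearMap.proj 0) (RingHom.ker (aeval (R := R) fun l ↦
    (Polynomial.C (f l) * Polynomial.X : Polynomial R)))

theorem mem_reesRelations {f : σ → R} {v : Fin 1 → MvPolynomial σ R} :
    v ∈ reesRelations f ↔ ∀ k, aeval f (homogeneousComponent k (v 0)) = 0 := by
  simp only [← coeff_aeval_C_mul_X]
  exact Polynomial.ext_iff

theorem aeval_homogeneousComponent_eq_ite (f : σ → R) {p : MvPolynomial σ R} {l : ℕ}
    (hp : p.IsHomogeneous l) (k : ℕ) :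
    aeval f (homogeneousComponent k p) = if k = l then aeval f p else 0 := by
  rw [homogeneousComponent_of_mem ((mem_homogeneousSubmodule _ _).2 hp)]
  split_ifs <;> simp

theorem isGradedSubmodule_reesRelations (f : σ → R) : IsGradedSubmodule (reesRelations f) := by
  intro k v hv
  rw [mem_reesRelations] at hv ⊢
  intro l
  rw [gradedProj_apply, aeval_homogeneousComponent_eq_ite f
    (homogeneousComponent_isHomogeneous k _), hv k, ite_self]

end Graded

section Syzygies

theorem IsStableRetract.congr {R M M' N N' : Type u} [CommRing R] [AddCommGroup M] [Module R M]
    [AddCommGroup M'] [Module R M'] [AddCommGroup N] [Module R N] [AddCommGroup N'] [Module R N']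
    (e : M ≃ₗ[R] N) (e' : M' ≃ₗ[R] N') (h : IsStableRetract R M M') : IsStableRetract R N N' := by
  obtain ⟨f, g, Q, p, q, hQ, hfg⟩ := h
  refine ⟨e' ∘ₗ f ∘ₗ e.symm, e ∘ₗ g ∘ₗ e'.symm, Q, p ∘ₗ e.symm, e ∘ₗ q, hQ, fun x ↦ ?_⟩
  simpa using congrArg e (hfg (e.symm x))

/-- The submodules `K ≤ P` and `L ≤ Q` are stably isomorphic, with the same Artin–Rees steps. -/
def SameSyzygy {R P W : Type u} [CommRing R] [AddCommGroup P] [Module R P]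
    [AddCommGroup W] [Module R W] (m : Ideal R) (K : Submodule R P) (L Q : Submodule R W) : Prop :=
  IsStableRetract R K L ∧ IsStableRetract R L K ∧
    ∀ i, ArtinReesStep m K ⊤ i ↔ ArtinReesStep m L Q i

theorem sameSyzygy {R M M' P W : Type u} [CommRing R] [AddCommGroup M] [Module R M]
    [AddCommGroup M'] [Module R M'] [AddCommGroup P] [Module R P] [AddCommGroup W] [Module R W]
    [Module.Projective R P] {Q : Submodule R W} [Module.Projective R Q]
    (h : IsStableRetract R M M') (h' : IsStableRetract R M' M) (m : Ideal R)
    {π : P →ₗ[R] M} (hπ : Function.Surjective π) {π' : Q →ₗ[R] M'} (hπ' : Function.Surjective π')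
    {K : Submodule R P} (hK : LinearMap.ker π = K) {L : Submodule R W}
    (hL : (LinearMap.ker π').map Q.subtype = L) : SameSyzygy m K L Q := by
  subst hK hL
  let e := Submodule.equivMapOfInjective Q.subtype Q.injective_subtype (LinearMap.ker π')
  refine ⟨(h.ker hπ hπ').congr (.refl _ _) e, (h'.ker hπ' hπ).congr e (.refl _ _), fun i ↦ ?_⟩
  have hQ : ArtinReesStep m ((LinearMap.ker π').map Q.subtype) Q i ↔
      ArtinReesStep m (LinearMap.ker π') ⊤ i := by
    rw [← artinReesStep_map_iff Q.injective_subtype, Submodule.map_top, Submodule.range_subtype]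
  rw [hQ]
  exact ⟨h'.artinReesStep hπ' hπ, h.artinReesStep hπ hπ'⟩

open MvPolynomial in
theorem sameSyzygy_reesRelations {R : Type u} [CommRing R] {σ : Type} (f : σ → R) (m : Ideal R)
    (k : ℕ) (F : MinFreeRes R m ↥(Ideal.span (Set.range f) ^ k)) :
    SameSyzygy m (LinearMap.range (F.d 0)) (strand (reesRelations f) k)
      (LinearMap.range (gradedProj R σ (Fin 1) k)) := by
  let ev : (Fin 1 → MvPolynomial σ R) →ₗ[R] R := (aeval f).toLinearMap ∘ₗ LinearMap.proj 0
  have hev (v) (hv : v ∈ LinearMap.range (gradedProj R σ (Fin 1) k)) :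
      ev v ∈ Ideal.span (Set.range f) ^ k :=
    (Ideal.mem_span_pow_iff_exists_isHomogeneous f _).2
      ⟨v 0, mem_range_gradedProj.1 hv 0, by simp [ev, aeval_eq_eval]⟩
  refine sameSyzygy (LinearEquiv.isStableRetract (.refl R _)) (LinearEquiv.isStableRetract (.refl R _)) m F.aug_surj
    (π' := ev.restrict hev) ?_ F.exact_aug ?_
  · rintro ⟨x, hx⟩
    obtain ⟨p, hp, rfl⟩ := (Ideal.mem_span_pow_iff_exists_isHomogeneous f x).1 hx
    exact ⟨⟨fun _ ↦ p, mem_range_gradedProj.2 fun _ ↦ hp⟩, Subtype.ext (by simp [ev, aeval_eq_eval])⟩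
  · ext v
    have hv (hv : v ∈ LinearMap.range (gradedProj R σ (Fin 1) k)) :
        v ∈ reesRelations f ↔ ev v = 0 := by
      simp only [mem_reesRelations,
        aeval_homogeneousComponent_eq_ite f (mem_range_gradedProj.1 hv 0)]
      exact ⟨fun h ↦ (if_pos rfl).symm.trans (h k), fun h l ↦ by split_ifs; exacts [h, rfl]⟩
    constructor
    · rintro ⟨w, hw, rfl⟩
      exact ⟨(hv w.2).2 (congrArg Subtype.val hw), w.2⟩
    · rintro ⟨h, hk⟩
      exact ⟨⟨v, hk⟩, Subtype.ext ((hv hk).1 h), rfl⟩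

theorem MinFreeRes.exists_sameSyzygy {R : Type u} [CommRing R] [IsNoetherianRing R] {σ : Type}
    [Finite σ] (f : σ → R) (m : Ideal R) (j : ℕ) :
    ∃ (n d : ℕ) (N : Submodule (MvPolynomial σ R) (Fin n → MvPolynomial σ R)),
      IsGradedSubmodule N ∧ ∀ k l, l = k + d →
        ∀ F : MinFreeRes R m ↥(Ideal.span (Set.range f) ^ l),
          SameSyzygy m (LinearMap.range (F.d j)) (strand N k)
            (LinearMap.range (gradedProj R σ (Fin n) k)) := by
  induction j with
  | zero =>
    refine ⟨1, 0, reesRelations f, isGradedSubmodule_reesRelations f, ?_⟩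
    rintro _ k rfl F
    exact sameSyzygy_reesRelations f m k F
  | succ j ih =>
    obtain ⟨n, d, N, hN, h⟩ := ih
    obtain ⟨n', d', φ, hφ, hφN⟩ := hN.exists_presentation
    refine ⟨n', d' + d, LinearMap.ker φ, hφ, fun k l hl F ↦ ?_⟩
    obtain ⟨h1, h2, -⟩ := h (k + d') l (by omega) F
    have hmem (v) (hv : v ∈ LinearMap.range (gradedProj R σ (Fin n') k)) :
        φ.restrictScalars R v ∈ strand N (k + d') := hφN k ▸ Submodule.mem_map_of_mem hv
    refine sameSyzygy h1 h2 m (F.d j).surjective_rangeRestrict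
      (π' := (φ.restrictScalars R).restrict hmem) ?_
      ((F.d j).ker_rangeRestrict.trans (F.exact j)) ?_
    · rintro ⟨x, hx⟩
      rw [← hφN k] at hx
      obtain ⟨v, hv, rfl⟩ := hx
      exact ⟨⟨v, hv⟩, rfl⟩
    · ext v
      constructor
      · rintro ⟨w, hw, rfl⟩
        exact ⟨congrArg Subtype.val hw, w.2⟩
      · rintro ⟨hv, hk⟩
        exact ⟨⟨v, hk⟩, Subtype.ext hv, rfl⟩

end Syzygies

/-- Let `(R, m)` be a Noetherian local ring and `I ⊆ m` an ideal.  Then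
for every `j ≥ 1` there is an integer `c_j` such that `ρ_j(I^k) = c_j` for all
sufficiently large `k`, where `ρ_j(I^k)` is the Artin–Rees number of the `j`-th syzygy
module of `I^k` inside the `(j-1)`-st free module of a minimal free `R`-resolution
of `I^k`. -/
theorem statement8 {R : Type*} [CommRing R] [IsNoetherianRing R] [IsLocalRing R]
    (I : Ideal R) (hI : I ≤ maximalIdeal R) :
    ∀ j : ℕ, 1 ≤ j → ∃ c k₀ : ℕ, ∀ k : ℕ, k₀ ≤ k →
      ∀ F : MinFreeRes R (maximalIdeal R) ↥(I ^ k), F.rho j = c := by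
  intro j _
  obtain ⟨s, f, rfl⟩ := Submodule.fg_iff_exists_fin_generating_family.1
    (IsNoetherian.noetherian I)
  obtain ⟨n, d, N, hN, h⟩ := MinFreeRes.exists_sameSyzygy f (maximalIdeal R) (j - 1)
  obtain ⟨k₀, hk₀⟩ := hN.exists_artinReesStep_iff (maximalIdeal R)
  refine ⟨sInf {r | ∀ i, r ≤ i → ArtinReesStep (maximalIdeal R) (strand N k₀)
    (LinearMap.range (gradedProj R (Fin s) (Fin n) k₀)) i}, k₀ + d, fun l hl F ↦ ?_⟩
  obtain ⟨-, -, hF⟩ := h (l - d) l (by omega) F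
  rw [MinFreeRes.rho, artinReesNumber_eq]
  simp only [hF, hk₀ (l - d) (by omega)]
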